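/- (Main theorem.) Let F ∈ 𝔉, let u ∈ W¹₁(-1,1) be nonnegative, and let the weight a : [-1,1] × [0,∞) → [0,∞) be continuous, even with respect to the first argument (a(x,v) = a(-x,v) for all x, v), and satisfy condition (C). Then I(a,u*) ≤ I(a,u). -/

import Mathlib

open MeasureTheory Set Filter
open scoped ENNReal BigOperators NNReal

noncomputable section

/-- `u ∈ W¹₁(-1,1)`: `u` is absolutely continuous on `[-1,1]` with (a.e.) derivative in `L¹`,
encoded via the fundamental theorem of calculus with the pointwise derivative `deriv u`. -/
def MemW11 (u : ℝ → ℝ) : Prop :=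
  IntegrableOn (deriv u) (Icc (-1 : ℝ) 1) volume ∧
  ∀ x ∈ Icc (-1 : ℝ) 1, u x = u (-1) + ∫ t in (-1 : ℝ)..x, deriv u t

/-- Convergence `u_k → u` in `W¹₁(-1,1)`. -/
def W11Tendsto (uk : ℕ → ℝ → ℝ) (u : ℝ → ℝ) : Prop :=
  Tendsto (fun k => ∫ x in Icc (-1 : ℝ) 1, (|uk k x - u x| + |deriv (uk k) x - deriv u x|))
    atTop (nhds 0)

/-- `F ∈ 𝔉`: continuous, nonnegative, convex and nondecreasing in the second argument. -/
def MemFrakF (F : ℝ → ℝ → ℝ) : Prop :=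
  ContinuousOn (fun p : ℝ × ℝ => F p.1 p.2) (Ici (0 : ℝ) ×ˢ Ici (0 : ℝ)) ∧
  (∀ v p : ℝ, 0 ≤ v → 0 ≤ p → 0 ≤ F v p) ∧
  (∀ v : ℝ, 0 ≤ v → ConvexOn ℝ (Ici (0 : ℝ)) (F v)) ∧
  (∀ v : ℝ, 0 ≤ v → MonotoneOn (F v) (Ici (0 : ℝ)))

/-- A continuous nonnegative weight on `[-1,1] × [0,∞)`. -/
def Weight (a : ℝ → ℝ → ℝ) : Prop :=
  ContinuousOn (fun p : ℝ × ℝ => a p.1 p.2) (Icc (-1 : ℝ) 1 ×ˢ Ici (0 : ℝ)) ∧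
  ∀ x v : ℝ, x ∈ Icc (-1 : ℝ) 1 → 0 ≤ v → 0 ≤ a x v

/-- Condition (C): `a(s,v) + a(t,v) ≥ a(1 - t + s, v)` for `-1 ≤ s ≤ t ≤ 1`, `v ≥ 0`. -/
def CondC (a : ℝ → ℝ → ℝ) : Prop :=
  ∀ s t v : ℝ, -1 ≤ s → s ≤ t → t ≤ 1 → 0 ≤ v → a (1 - t + s) v ≤ a s v + a t v

/-- Condition (C) for a one-variable weight. -/
def CondC1 (a : ℝ → ℝ) : Prop :=
  ∀ s t : ℝ, -1 ≤ s → s ≤ t → t ≤ 1 → a (1 - t + s) ≤ a s + a t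

/-- Condition (C'): `a(s,v) + a(t,v) ≥ a((s-t)/2, v) + a((t-s)/2, v)`. -/
def CondC' (a : ℝ → ℝ → ℝ) : Prop :=
  ∀ s t v : ℝ, s ∈ Icc (-1 : ℝ) 1 → t ∈ Icc (-1 : ℝ) 1 → 0 ≤ v →
    a ((s - t) / 2) v + a ((t - s) / 2) v ≤ a s v + a t v

/-- The functional `I(a,u) = ∫_{-1}^1 F(u(x), a(x,u(x))·|u'(x)|) dx ∈ [0,∞]`. -/
def Ifun (F a : ℝ → ℝ → ℝ) (u : ℝ → ℝ) : ℝ≥0∞ :=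
  ∫⁻ x in Icc (-1 : ℝ) 1, ENNReal.ofReal (F (u x) (a x (u x) * |deriv u x|))

/-- The monotone rearrangement `u*(x) = ∫₀^∞ χ_{[1-|A_t|,1]}(x) dt`,
where `A_t = {y ∈ [-1,1] : u(y) > t}`. -/
def mrear (u : ℝ → ℝ) (x : ℝ) : ℝ :=
  ∫ t in Ioi (0 : ℝ),
    (Icc (1 - (volume {y ∈ Icc (-1 : ℝ) 1 | u y > t}).toReal) 1).indicator
      (fun _ => (1 : ℝ)) x

/-- The symmetric rearrangement `ū(x) = ∫₀^∞ χ_{[-|A_t|/2, |A_t|/2]}(x) dt`. -/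
def srear (u : ℝ → ℝ) (x : ℝ) : ℝ :=
  ∫ t in Ioi (0 : ℝ),
    (Icc (-((volume {y ∈ Icc (-1 : ℝ) 1 | u y > t}).toReal / 2))
        ((volume {y ∈ Icc (-1 : ℝ) 1 | u y > t}).toReal / 2)).indicator
      (fun _ => (1 : ℝ)) x

/-- `u` is piecewise linear on `[-1,1]`: there is a partition `-1 = x₀ < ⋯ < x_n = 1`
such that `u` is affine on each `[x_i, x_{i+1}]`. -/
def PiecewiseLinear (u : ℝ → ℝ) : Prop :=
  ∃ n : ℕ, ∃ x : Fin (n + 1) → ℝ, x 0 = -1 ∧ x (Fin.last n) = 1 ∧ StrictMono x ∧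
    ∀ i : Fin n, ∃ c d : ℝ, ∀ y ∈ Icc (x i.castSucc) (x i.succ), u y = c * y + d

lemma jensen_weighted {ι : Type*} (S : Finset ι) {φ : ℝ → ℝ} (hconv : ConvexOn ℝ (Ici 0) φ)
    (hmono : MonotoneOn φ (Ici 0)) {q b₀ : ℝ} {p b : ι → ℝ} (hq : 0 < q) (hp : ∀ i ∈ S, 0 < p i)
    (hb : ∀ i ∈ S, 0 ≤ b i) (hb₀ : 0 ≤ b₀) (hsum : ∑ i ∈ S, q / p i ≤ 1)
    (hle : b₀ ≤ ∑ i ∈ S, b i) :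
    (φ (b₀ * q) - φ 0) / q ≤ ∑ i ∈ S, (φ (b i * p i) - φ 0) / p i := by
  have hJ := hconv.map_add_sum_le (t := S) (w := fun i => q / p i) (p := fun i => b i * p i)
    (v := 1 - ∑ i ∈ S, q / p i) (q := 0) (fun i hi => (div_pos hq (hp i hi)).le) (by ring)
    (fun i hi => mul_nonneg (hb i hi) (hp i hi).le) (by linarith) (by simp)
  have h1 : ∑ i ∈ S, (q / p i) • (b i * p i) = (∑ i ∈ S, b i) * q := by
    rw [Finset.sum_mul]
    refine Finset.sum_congr rfl fun i hi => ?_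
    have := (hp i hi).ne'
    simp only [smul_eq_mul]
    field_simp
  rw [h1, smul_zero, zero_add] at hJ
  have h2 : φ (b₀ * q) ≤ φ ((∑ i ∈ S, b i) * q) :=
    hmono (mul_nonneg hb₀ hq.le) (mul_nonneg (hb₀.trans hle) hq.le)
      (mul_le_mul_of_nonneg_right hle hq.le)
  rw [div_le_iff₀ hq, Finset.sum_mul]
  have h3 : ∑ i ∈ S, (φ (b i * p i) - φ 0) / p i * q
      = ∑ i ∈ S, (q / p i) • φ (b i * p i) - (∑ i ∈ S, q / p i) * φ 0 := by
    rw [Finset.sum_mul, ← Finset.sum_sub_distrib]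
    refine Finset.sum_congr rfl fun i hi => ?_
    simp only [smul_eq_mul]
    ring
  rw [h3]
  simp only [smul_eq_mul] at hJ h2 ⊢
  linarith

lemma pos_of_ne_zero_of_ordConnected {g : ℝ → ℝ} (hg : Continuous g) {T : Set ℝ}
    (hT : T.OrdConnected) (hne : ∀ x ∈ T, g x ≠ 0) {y z : ℝ} (hy : y ∈ T) (hz : z ∈ T)
    (hpos : 0 < g y) : 0 < g z := by
  by_contra! h
  obtain ⟨x, hx, hx0⟩ := hT.isPreconnected.intermediate_value hz hy hg.continuousOn ⟨h, hpos.le⟩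
  exact hne x hx hx0

lemma exists_pos_mul_of_hasDerivAt {g : ℝ → ℝ} {c d : ℝ} (h : HasDerivAt g d c) (hc : g c = 0)
    (hd : 0 < d) : ∃ δ > 0, ∀ x, x ≠ c → |x - c| < δ → 0 < g x * (x - c) := by
  have h1 := (hasDerivAt_iff_tendsto_slope.1 h).eventually (lt_mem_nhds hd)
  rw [eventually_nhdsWithin_iff, Metric.eventually_nhds_iff] at h1
  obtain ⟨δ, hδ, H⟩ := h1
  refine ⟨δ, hδ, fun x hx hxd => ?_⟩
  have h2 := H (by rwa [Real.dist_eq]) hx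
  rw [slope_def_field, hc, sub_zero] at h2
  have h3 : g x * (x - c) = g x / (x - c) * (x - c) ^ 2 := by
    have := sub_ne_zero.2 hx
    field_simp
  rw [h3]
  have := sub_ne_zero.2 hx
  positivity

lemma pos_right_of_hasDerivAt {g : ℝ → ℝ} (hg : Continuous g) {c d e : ℝ} (h : HasDerivAt g d c)
    (hc : g c = 0) (hd : 0 < d) {T : Set ℝ} (hT : T.OrdConnected) (hne : ∀ x ∈ T, g x ≠ 0)
    (hce : c < e) (hsub : Ioo c e ⊆ T) : ∀ x ∈ T, 0 < g x := by
  obtain ⟨δ, hδ, H⟩ := exists_pos_mul_of_hasDerivAt h hc hd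
  obtain ⟨y, hy1, hy2⟩ := exists_between (lt_min hce (show c < c + δ by linarith))
  have hy3 := lt_min_iff.1 hy2
  have h1 := H y hy1.ne' (by rw [abs_of_pos (by linarith)]; linarith)
  intro x hx
  exact pos_of_ne_zero_of_ordConnected hg hT hne (hsub ⟨hy1, hy3.1⟩) hx
    (pos_of_mul_pos_left h1 (by linarith))

lemma neg_left_of_hasDerivAt {g : ℝ → ℝ} (hg : Continuous g) {c d e : ℝ} (h : HasDerivAt g d c)
    (hc : g c = 0) (hd : 0 < d) {T : Set ℝ} (hT : T.OrdConnected) (hne : ∀ x ∈ T, g x ≠ 0)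
    (hce : e < c) (hsub : Ioo e c ⊆ T) : ∀ x ∈ T, g x < 0 := by
  obtain ⟨δ, hδ, H⟩ := exists_pos_mul_of_hasDerivAt h hc hd
  obtain ⟨y, hy1, hy2⟩ := exists_between (max_lt hce (show c - δ < c by linarith))
  have hy3 := max_lt_iff.1 hy1
  have h1 := H y hy2.ne (by rw [abs_of_neg (by linarith)]; linarith)
  intro x hx
  have := pos_of_ne_zero_of_ordConnected (g := fun x => -g x) hg.neg hT
    (fun x hx => neg_ne_zero.2 (hne x hx)) (hsub ⟨hy3.1, hy2⟩) hx (by nlinarith)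
  linarith

lemma volume_pos_add_volume_neg {g : ℝ → ℝ} (hg : Continuous g) {T : Set ℝ}
    (hfin : volume T ≠ ⊤) (hz : volume {x ∈ T | g x = 0} = 0) :
    (volume {x ∈ T | 0 < g x}).toReal + (volume {x ∈ T | 0 < -g x}).toReal
      = (volume T).toReal := by
  have hm : MeasurableSet {x | 0 < g x} := measurableSet_lt measurable_const hg.measurable
  have h1 := measure_inter_add_sdiff (μ := volume) T hm
  have h2 : volume (T \ {x | 0 < g x}) = volume {x ∈ T | 0 < -g x} := by
    apply le_antisymm
    · calc _ ≤ volume ({x ∈ T | 0 < -g x} ∪ {x ∈ T | g x = 0}) := by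
            apply measure_mono
            rintro x ⟨hx, hx'⟩
            rcases lt_or_eq_of_le (show g x ≤ 0 from not_lt.1 hx') with h | h
            · exact Or.inl ⟨hx, by simpa using h⟩
            · exact Or.inr ⟨hx, h⟩
        _ ≤ _ := (measure_union_le _ _).trans (by rw [hz, add_zero])
    · apply measure_mono
      rintro x ⟨hx, hx'⟩
      exact ⟨hx, fun h : 0 < g x => by linarith⟩
  rw [h2] at h1
  rw [← h1, ENNReal.toReal_add]
  · rfl
  · exact measure_ne_top_of_subset inter_subset_left hfin
  · exact measure_ne_top_of_subset (fun x hx => hx.1) hfin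

lemma weight_le_sum_right {b : ℝ → ℝ}
    (hC : ∀ s t, -1 ≤ s → s ≤ t → t ≤ 1 → b (1 - t + s) ≤ b s + b t) (S : Finset ℝ) (n : ℕ) :
    ∀ g g' : ℝ → ℝ, Continuous g → (∀ x ∈ Icc (-1 : ℝ) 1, g x = 0 ↔ x ∈ S) →
    (∀ x ∈ S, x ∈ Ioo (-1 : ℝ) 1 ∧ HasDerivAt g (g' x) x ∧ g' x ≠ 0) →
    ∀ c ∈ S, 0 < g' c → (S.filter (c < ·)).card = n →
    b (1 - (volume {x ∈ Ioc c 1 | 0 < g x}).toReal) ≤ b c + ∑ x ∈ S.filter (c < ·), b x := by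
  induction n with
  | zero =>
    intro g g' hg hS hd c hc hpos hn
    have hemp := Finset.card_eq_zero.1 hn
    have hc1 := (hd c hc).1
    have key : ∀ x ∈ Ioc c 1, 0 < g x := by
      refine pos_right_of_hasDerivAt hg (hd c hc).2.1 ((hS c (Ioo_subset_Icc_self hc1)).2 hc) hpos
        ordConnected_Ioc ?_ hc1.2 Ioo_subset_Ioc_self
      intro x hx h0
      have : x ∈ S.filter (c < ·) :=
        Finset.mem_filter.2 ⟨(hS x ⟨by linarith [hx.1, hc1.1], hx.2⟩).1 h0, hx.1⟩
      simp [hemp] at this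
    have hset : {x ∈ Ioc c 1 | 0 < g x} = Ioc c 1 := by
      ext x; exact ⟨fun h => h.1, fun h => ⟨h, key x h⟩⟩
    rw [hset, hemp, Real.volume_Ioc, ENNReal.toReal_ofReal (by linarith [hc1.2])]
    simp
  | succ n ih =>
    intro g g' hg hS hd c hc hpos hn
    have hne : (S.filter (c < ·)).Nonempty := Finset.card_pos.1 (by omega)
    set y := (S.filter (c < ·)).min' hne with hy
    have hyS := Finset.mem_filter.1 (Finset.min'_mem _ hne)
    rw [← hy] at hyS
    obtain ⟨hyS, hcy⟩ := hyS
    have hc1 := (hd c hc).1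
    have hy1 := (hd y hyS).1
    have hno : ∀ x ∈ Ioo c y, g x ≠ 0 := by
      intro x hx h0
      have : x ∈ S.filter (c < ·) := Finset.mem_filter.2
        ⟨(hS x ⟨by linarith [hx.1, hc1.1], by linarith [hx.2, hy1.2]⟩).1 h0, hx.1⟩
      exact absurd (Finset.min'_le _ _ this) (not_le.2 hx.2)
    have hgc := (hS c (Ioo_subset_Icc_self hc1)).2 hc
    have hgy := (hS y (Ioo_subset_Icc_self hy1)).2 hyS
    have key : ∀ x ∈ Ioo c y, 0 < g x :=
      pos_right_of_hasDerivAt hg (hd c hc).2.1 hgc hpos ordConnected_Ioo hno hcy subset_rfl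
    have hyneg : g' y < 0 := by
      rcases lt_or_gt_of_ne (hd y hyS).2.2 with h | h
      · exact h
      · have := neg_left_of_hasDerivAt hg (hd y hyS).2.1 hgy h ordConnected_Ioo hno hcy subset_rfl
        obtain ⟨z, hz⟩ := exists_between hcy
        exact absurd (key z hz) (not_lt.2 (this z hz).le)
    have hins : S.filter (c < ·) = insert y (S.filter (y < ·)) := by
      ext x
      simp only [Finset.mem_filter, Finset.mem_insert]
      constructor
      · intro h
        rcases eq_or_lt_of_le (Finset.min'_le _ x (Finset.mem_filter.2 h)) with h' | h'
        · exact Or.inl h'.symm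
        · exact Or.inr ⟨h.1, h'⟩
      · rintro (rfl | h)
        · exact ⟨hyS, hcy⟩
        · exact ⟨h.1, hcy.trans h.2⟩
    have hnot : y ∉ S.filter (y < ·) := by simp
    have hcard : (S.filter (y < ·)).card = n := by
      rw [hins, Finset.card_insert_of_notMem hnot] at hn
      omega
    have IH := ih (fun x => -g x) (fun x => -g' x) hg.neg (fun x hx => by
        rw [neg_eq_zero]; exact hS x hx)
      (fun x hx => ⟨(hd x hx).1, (hd x hx).2.1.neg, neg_ne_zero.2 (hd x hx).2.2⟩) y hyS
      (by simpa using hyneg) hcard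
    have hsum := volume_pos_add_volume_neg hg (T := Ioc y 1) (by simp) (by
      refine measure_mono_null (t := ↑S) ?_ (S.measure_zero volume)
      intro x hx
      exact (hS x ⟨by linarith [hx.1.1, hy1.1], hx.1.2⟩).1 hx.2)
    rw [Real.volume_Ioc, ENNReal.toReal_ofReal (by linarith [hy1.2])] at hsum
    have hsplit : (volume {x ∈ Ioc c 1 | 0 < g x}).toReal
        = (y - c) + (volume {x ∈ Ioc y 1 | 0 < g x}).toReal := by
      have : {x ∈ Ioc c 1 | 0 < g x} = Ioo c y ∪ {x ∈ Ioc y 1 | 0 < g x} := by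
        ext x
        simp only [mem_ofPred_eq, mem_union, mem_Ioc, mem_Ioo]
        constructor
        · rintro ⟨⟨h1, h2⟩, h3⟩
          rcases lt_trichotomy x y with h | h | h
          · exact Or.inl ⟨h1, h⟩
          · rw [h, hgy] at h3; exact absurd h3 (lt_irrefl _)
          · exact Or.inr ⟨⟨h, h2⟩, h3⟩
        · rintro (h | h)
          · exact ⟨⟨h.1, by linarith [hy1.2]⟩, key x h⟩
          · exact ⟨⟨hcy.trans h.1.1, h.1.2⟩, h.2⟩
      rw [this, measure_union' _ measurableSet_Ioo, ENNReal.toReal_add (by simp)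
        (measure_ne_top_of_subset (fun x hx => hx.1) (measure_Ioc_lt_top (a := y) (b := 1)).ne),
        Real.volume_Ioo, ENNReal.toReal_ofReal (by linarith)]
      rw [Set.disjoint_left]
      intro x hx hx'
      exact absurd hx.2 (not_lt.2 hx'.1.1.le)
    set m := (volume {x ∈ Ioc y 1 | 0 < g x}).toReal
    set m' := (volume {x ∈ Ioc y 1 | 0 < -g x}).toReal
    have hm : 0 ≤ m := ENNReal.toReal_nonneg
    have hm' : 0 ≤ m' := ENNReal.toReal_nonneg
    have h2 := hC c (1 - m') hc1.1.le (by linarith) (by linarith)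
    rw [hsplit, hins, Finset.sum_insert hnot]
    have h3 : 1 - (y - c + m) = 1 - (1 - m') + c := by linarith
    rw [h3]
    linarith

lemma weight_le_sum {b : ℝ → ℝ}
    (hC : ∀ s t, -1 ≤ s → s ≤ t → t ≤ 1 → b (1 - t + s) ≤ b s + b t)
    (heven : ∀ x ∈ Icc (-1 : ℝ) 1, b x = b (-x)) {S : Finset ℝ} (hne : S.Nonempty)
    {g g' : ℝ → ℝ} (hg : Continuous g) (hS : ∀ x ∈ Icc (-1 : ℝ) 1, g x = 0 ↔ x ∈ S)
    (hd : ∀ x ∈ S, x ∈ Ioo (-1 : ℝ) 1 ∧ HasDerivAt g (g' x) x ∧ g' x ≠ 0) :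
    b (1 - (volume {x ∈ Icc (-1 : ℝ) 1 | 0 < g x}).toReal) ≤ ∑ x ∈ S, b x := by
  set c := S.min' hne with hc
  have hcS : c ∈ S := S.min'_mem hne
  have hins : S = insert c (S.filter (c < ·)) := by
    ext x
    simp only [Finset.mem_filter, Finset.mem_insert]
    constructor
    · intro h
      rcases eq_or_lt_of_le (S.min'_le x h) with h' | h'
      · exact Or.inl h'.symm
      · exact Or.inr ⟨h, h'⟩
    · rintro (rfl | h)
      exacts [hcS, h.1]
  have hsumS : ∑ x ∈ S, b x = b c + ∑ x ∈ S.filter (c < ·), b x := by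
    conv_lhs => rw [hins]
    rw [Finset.sum_insert (by simp)]
  have hc1 := (hd c hcS).1
  have hno : ∀ x ∈ Ico (-1) c, g x ≠ 0 := fun x hx h0 =>
    absurd (S.min'_le x ((hS x ⟨hx.1, by linarith [hx.2, hc1.2]⟩).1 h0)) (not_le.2 hx.2)
  have hgc := (hS c (Ioo_subset_Icc_self hc1)).2 hcS
  have hleft : ∀ f f' : ℝ → ℝ, Continuous f → (∀ x ∈ Ico (-1) c, f x ≠ 0) → f c = 0 →
      HasDerivAt f (f' c) c → 0 < f' c →
      {x ∈ Icc (-1 : ℝ) 1 | 0 < f x} = {x ∈ Ioc c 1 | 0 < f x} := by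
    intro f f' hf h0 hfc hfd hpos
    have hneg := neg_left_of_hasDerivAt hf hfd hfc hpos ordConnected_Ico h0 hc1.1
      Ioo_subset_Ico_self
    ext x
    constructor
    · rintro ⟨h1, h2⟩
      rcases lt_trichotomy x c with h | h | h
      · exact absurd h2 (not_lt.2 (hneg x ⟨h1.1, h⟩).le)
      · simp only [h, hfc] at h2; exact absurd h2 (lt_irrefl _)
      · exact ⟨⟨h, h1.2⟩, h2⟩
    · rintro ⟨h1, h2⟩
      exact ⟨⟨by linarith [h1.1, hc1.1], h1.2⟩, h2⟩
  rw [hsumS]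
  rcases lt_or_gt_of_ne (hd c hcS).2.2 with h | h
  · have H := weight_le_sum_right hC S _ (fun x => -g x) (fun x => -g' x) hg.neg
      (fun x hx => by rw [neg_eq_zero]; exact hS x hx)
      (fun x hx => ⟨(hd x hx).1, (hd x hx).2.1.neg, neg_ne_zero.2 (hd x hx).2.2⟩) c hcS
      (by simpa using h) rfl
    rw [← hleft (fun x => -g x) (fun x => -g' x) hg.neg (fun x hx => neg_ne_zero.2 (hno x hx))
      (by simpa using hgc) (hd c hcS).2.1.neg (by simpa using h)] at H
    have hsum := volume_pos_add_volume_neg hg (T := Icc (-1) 1) (by simp) (by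
      refine measure_mono_null (t := ↑S) ?_ (S.measure_zero volume)
      intro x hx
      exact (hS x hx.1).1 hx.2)
    rw [Real.volume_Icc, ENNReal.toReal_ofReal (by norm_num)] at hsum
    set m := (volume {x ∈ Icc (-1 : ℝ) 1 | 0 < g x}).toReal
    set m' := (volume {x ∈ Icc (-1 : ℝ) 1 | 0 < -g x}).toReal
    have hm : 0 ≤ m := ENNReal.toReal_nonneg
    have hm' : 0 ≤ m' := ENNReal.toReal_nonneg
    rw [heven (1 - m) ⟨by linarith, by linarith⟩]
    have : -(1 - m) = 1 - m' := by linarith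
    rwa [this]
  · rw [hleft g g' hg hno hgc (hd c hcS).2.1 h]
    exact weight_le_sum_right hC S _ g g' hg hS hd c hcS h rfl

lemma volume_image_primitive_eq_zero {f : ℝ → ℝ} (hf : Integrable f) (c : ℝ) {Z : Set ℝ}
    (hZ : MeasurableSet Z) (h0 : ∀ x ∈ Z, f x = 0) :
    volume ((fun x => c + ∫ t in (-1 : ℝ)..x, f t) '' Z) = 0 := by
  set w : ℝ → ℝ := fun x => c + ∫ t in (-1 : ℝ)..x, f t with hw
  have hint : ∀ a b, IntervalIntegrable f volume a b := fun a b => hf.intervalIntegrable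
  have hint' : ∀ a b, IntervalIntegrable (fun x => |f x|) volume a b :=
    fun a b => hf.abs.intervalIntegrable
  have hsub : ∀ a b, (∫ t in (-1 : ℝ)..b, |f t|) - (∫ t in (-1 : ℝ)..a, |f t|)
      = ∫ t in a..b, |f t| := fun a b =>
    intervalIntegral.integral_interval_sub_left (hint' _ _) (hint' _ _)
  have hwsub : ∀ a b, w b - w a = ∫ t in a..b, f t := fun a b => by
    rw [← intervalIntegral.integral_interval_sub_left (hint (-1) b) (hint (-1) a)]
    simp only [hw]; ring
  let W : StieltjesFunction ℝ :=
    { toFun := fun x => ∫ t in (-1 : ℝ)..x, |f t|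
      mono' := fun a b hab => by
        have := intervalIntegral.integral_nonneg (μ := volume) hab (fun t _ => abs_nonneg (f t))
        rw [← hsub] at this
        exact sub_nonneg.1 this
      right_continuous' := fun x =>
        (intervalIntegral.continuous_primitive hint' _).continuousWithinAt }
  have hW : ∀ a b, W b - W a = ∫ t in a..b, |f t| := hsub
  have hmeas : W.measure = volume.withDensity (fun x => ENNReal.ofReal |f x|) := by
    refine Measure.ext_of_Ioc _ _ fun a b hab => ?_
    rw [StieltjesFunction.measure_Ioc, hW, intervalIntegral.integral_of_le hab.le,
      ofReal_integral_eq_lintegral_ofReal hf.abs.integrableOn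
        (Eventually.of_forall fun x => abs_nonneg _), withDensity_apply _ measurableSet_Ioc]
  have hle : OuterMeasure.comap w volume.toOuterMeasure ≤ W.outer := by
    refine OuterMeasure.le_ofFunction.2 fun s => ?_
    rw [StieltjesFunction.length_eq]
    refine le_iInf fun a => le_iInf fun b => le_iInf fun hs => ?_
    have hs' : s ⊆ Ioc a b := fun x hx => hs ⟨hx, notMem_botSet_of_lt (sub_one_lt x)⟩
    rw [OuterMeasure.comap_apply, hW]
    rcases le_or_gt b a with hab | hab
    · have : s = ∅ := by
        rw [Ioc_eq_empty (not_lt.2 hab)] at hs'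
        exact subset_empty_iff.1 hs'
      simp [this]
    · have hab' := hab.le
      have hbd : ∀ x ∈ s, ∀ y ∈ s, |w x - w y| ≤ ∫ t in a..b, |f t| := by
        have key : ∀ x ∈ s, ∀ y ∈ s, x ≤ y → |w x - w y| ≤ ∫ t in a..b, |f t| := by
          intro x hx y hy hxy
          rw [abs_sub_comm, hwsub]
          refine (intervalIntegral.abs_integral_le_integral_abs hxy).trans ?_
          rw [← hW, ← hW]
          have h1 := W.mono (hs' hx).1.le
          have h2 := W.mono (hs' hy).2
          linarith
        intro x hx y hy
        rcases le_total x y with h | h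
        · exact key x hx y hy h
        · rw [abs_sub_comm]; exact key y hy x hx h
      refine (Real.volume_le_diam _).trans ?_
      refine Metric.ediam_le fun p hp q hq => ?_
      obtain ⟨x, hx, rfl⟩ := hp
      obtain ⟨y, hy, rfl⟩ := hq
      rw [edist_dist, Real.dist_eq]
      exact ENNReal.ofReal_le_ofReal (hbd x hx y hy)
  have h1 : volume (w '' Z) ≤ W.measure Z := by
    rw [StieltjesFunction.measure]
    exact hle Z
  refine le_antisymm (h1.trans ?_) zero_le
  rw [hmeas, withDensity_apply _ hZ, setLIntegral_congr_fun (g := fun _ => 0) hZ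
    (fun x hx => by simp [h0 x hx])]
  simp

lemma lintegral_le_of_fiberwise_le {u u' : ℝ → ℝ} {E : Set ℝ} (hE : MeasurableSet E)
    (hd : ∀ x ∈ E, HasDerivWithinAt u (u' x) E x) (hne : ∀ x ∈ E, u' x ≠ 0) {H : ℝ → ℝ≥0∞}
    (hH : Measurable H) {Φ : ℝ → ℝ≥0∞}
    (h : ∀ᵐ v, ∃ S : Finset ℝ, ↑S ⊆ E ∧ (∀ x ∈ S, u x = v) ∧ Φ v ≤ ∑ x ∈ S, H x) :
    ∫⁻ v, Φ v ≤ ∫⁻ x in E, ENNReal.ofReal |u' x| * H x := by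
  classical
  let D : ℝ → ℝ →L[ℝ] ℝ := fun x => ContinuousLinearMap.toSpanSingleton ℝ (u' x)
  have hD : ∀ x ∈ E, HasFDerivWithinAt u (D x) E x := fun x hx => (hd x hx).hasFDerivWithinAt
  obtain ⟨t, A, tdisj, tmeas, tcov, tapprox, hA⟩ :=
    exists_partition_approximatesLinearOn_of_hasFDerivWithinAt u E D hD
      (fun A => if A = 0 then 1 else ‖A 1‖₊ / 2) (fun A => by
        split_ifs with h0
        · exact one_ne_zero
        · have : A 1 ≠ 0 := fun h1 => h0 (ContinuousLinearMap.ext_ring (by simpa using h1))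
          simpa using this)
  have hinj : ∀ n, InjOn u (E ∩ t n) := by
    intro n x hx y hy hxy
    obtain ⟨z, hz, hAz⟩ := hA ⟨x, hx.1⟩ n
    have hA1 : A n 1 = u' z := by rw [hAz]; simp [D]
    have hA0 : A n ≠ 0 := fun h0 => hne z hz (by rw [← hA1, h0]; simp)
    have hap := tapprox n x hx y hy
    rw [hxy, sub_self, zero_sub, norm_neg, if_neg hA0] at hap
    have h3 : A n (x - y) = (x - y) * u' z := by
      rw [← hA1]
      conv_lhs => rw [show x - y = (x - y) • (1 : ℝ) by simp, map_smul]
      simp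
    rw [h3] at hap
    simp only [NNReal.coe_div, coe_nnnorm, hA1, Real.norm_eq_abs, abs_mul, NNReal.coe_ofNat] at hap
    by_contra hcon
    have h4 : 0 < |x - y| := abs_pos.2 (sub_ne_zero.2 hcon)
    have h5 : 0 < |u' z| := abs_pos.2 (hne z hz)
    nlinarith [mul_pos h4 h5]
  have hEm : ∀ n, MeasurableSet (E ∩ t n) := fun n => hE.inter (tmeas n)
  have hD' : ∀ n, ∀ x ∈ E ∩ t n, HasFDerivWithinAt u (D x) (E ∩ t n) x :=
    fun n x hx => (hD x hx.1).mono inter_subset_left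
  have himg : ∀ n, MeasurableSet (u '' (E ∩ t n)) := fun n =>
    measurable_image_of_fderivWithin (hEm n) (hD' n) (hinj n)
  have hext : ∀ n, ∃ g : ℝ → ℝ≥0∞, Measurable g ∧ ∀ x ∈ E ∩ t n, g (u x) = H x := by
    intro n
    obtain ⟨g, hg, hg'⟩ := (measurableEmbedding_of_fderivWithin (hEm n) (hD' n)
      (hinj n)).exists_measurable_extend (g := fun x => H x) (hH.comp measurable_subtype_coe)
      (fun _ => ⟨0⟩)
    exact ⟨g, hg, fun x hx => congr_fun hg' ⟨x, hx⟩⟩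
  choose g hg hgu using hext
  have hEU : E = ⋃ n, E ∩ t n := by
    rw [← inter_iUnion]
    exact (inter_eq_left.2 tcov).symm
  have hint : ∫⁻ x in E, ENNReal.ofReal |u' x| * H x
      = ∫⁻ v, ∑' n, (u '' (E ∩ t n)).indicator (g n) v := by
    rw [lintegral_tsum fun n => ((hg n).indicator (himg n)).aemeasurable]
    conv_lhs => rw [hEU]
    rw [lintegral_iUnion hEm (fun i j hij => (tdisj hij).mono inter_subset_right inter_subset_right)]
    refine tsum_congr fun n => ?_
    rw [lintegral_indicator (himg n), lintegral_image_eq_lintegral_abs_deriv_mul (hEm n)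
      (fun x hx => (hd x hx.1).mono inter_subset_left) (hinj n)]
    refine setLIntegral_congr_fun (hEm n) fun x hx => ?_
    simp only [hgu n x hx]
  rw [hint]
  refine lintegral_mono_ae ?_
  filter_upwards [h] with v hv
  obtain ⟨S, hSE, hSv, hle⟩ := hv
  have hidx : ∀ x : ℝ, ∃ n, x ∈ S → x ∈ E ∩ t n := by
    intro x
    by_cases hx : x ∈ S
    · have := hSE hx
      rw [hEU] at this
      obtain ⟨n, hn⟩ := mem_iUnion.1 this
      exact ⟨n, fun _ => hn⟩
    · exact ⟨0, fun h => absurd h hx⟩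
  choose idx hidx using hidx
  refine hle.trans ?_
  have hinjS : Set.InjOn idx ↑S := by
    intro x hx y hy hxy
    have h1 := hidx x hx
    have h2 := hidx y hy
    rw [← hxy] at h2
    exact hinj _ h1 h2 (by rw [hSv x hx, hSv y hy])
  calc ∑ x ∈ S, H x = ∑ x ∈ S, (u '' (E ∩ t (idx x))).indicator (g (idx x)) v := by
        refine Finset.sum_congr rfl fun x hx => ?_
        rw [indicator_of_mem (show v ∈ u '' (E ∩ t (idx x)) from ⟨x, hidx x hx, hSv x hx⟩),
          ← hSv x hx, hgu _ x (hidx x hx)]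
    _ = ∑ n ∈ S.image idx, (u '' (E ∩ t n)).indicator (g n) v :=
        (Finset.sum_image (f := fun n => (u '' (E ∩ t n)).indicator (g n) v) hinjS).symm
    _ ≤ _ := ENNReal.sum_le_tsum _

section Rearrangement

variable {u : ℝ → ℝ}

lemma measurable_distribution (u : ℝ → ℝ) :
    Measurable fun t => (volume {y ∈ Icc (-1 : ℝ) 1 | u y > t}).toReal := by
  refine Antitone.measurable fun s t hst => ?_
  refine ENNReal.toReal_mono (measure_ne_top_of_subset (fun x hx => hx.1)
    (measure_Icc_lt_top (a := (-1 : ℝ)) (b := 1)).ne) (measure_mono ?_)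
  exact fun x hx => ⟨hx.1, lt_of_le_of_lt hst hx.2⟩

lemma distribution_ne_top (u : ℝ → ℝ) (t : ℝ) : volume {y ∈ Icc (-1 : ℝ) 1 | u y > t} ≠ ⊤ :=
  measure_ne_top_of_subset (fun _ hx => hx.1) (measure_Icc_lt_top (a := (-1 : ℝ)) (b := 1)).ne

lemma distribution_le_two (u : ℝ → ℝ) (t : ℝ) :
    (volume {y ∈ Icc (-1 : ℝ) 1 | u y > t}).toReal ≤ 2 := by
  have := ENNReal.toReal_mono (measure_Icc_lt_top (a := (-1 : ℝ)) (b := 1)).ne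
    (measure_mono (μ := volume) (fun (x : ℝ) (hx : x ∈ {y ∈ Icc (-1 : ℝ) 1 | u y > t}) => hx.1))
  rw [Real.volume_Icc, ENNReal.toReal_ofReal (by norm_num)] at this
  linarith

lemma distribution_antitone (u : ℝ → ℝ) {s t : ℝ} (hst : s ≤ t) :
    (volume {y ∈ Icc (-1 : ℝ) 1 | u y > t}).toReal
      ≤ (volume {y ∈ Icc (-1 : ℝ) 1 | u y > s}).toReal :=
  ENNReal.toReal_mono (distribution_ne_top u s)
    (measure_mono fun _ hx => ⟨hx.1, lt_of_le_of_lt hst hx.2⟩)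

lemma mrear_nonneg (u : ℝ → ℝ) (x : ℝ) : 0 ≤ mrear u x :=
  integral_nonneg fun _ => indicator_nonneg (fun _ _ => zero_le_one) _

lemma mrear_eq_volume (u : ℝ → ℝ) {x : ℝ} (hx : x < 1) :
    mrear u x = (volume (Ioi (0 : ℝ) ∩
      {t | 1 - (volume {y ∈ Icc (-1 : ℝ) 1 | u y > t}).toReal ≤ x})).toReal := by
  unfold mrear
  have hm : MeasurableSet {t | 1 - (volume {y ∈ Icc (-1 : ℝ) 1 | u y > t}).toReal ≤ x} :=
    measurableSet_le (measurable_const.sub (measurable_distribution u)) measurable_const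
  have : ∀ t, (Icc (1 - (volume {y ∈ Icc (-1 : ℝ) 1 | u y > t}).toReal) 1).indicator
      (fun _ => (1 : ℝ)) x
      = {t | 1 - (volume {y ∈ Icc (-1 : ℝ) 1 | u y > t}).toReal ≤ x}.indicator
        (fun _ => (1 : ℝ)) t := by
    intro t
    simp only [indicator_apply, mem_Icc, hx.le, and_true, mem_ofPred_eq]
  simp_rw [this]
  rw [setIntegral_indicator hm]
  simp [Measure.real]

lemma superlevel_subset_Ioo {M : ℝ} (hM : ∀ x ∈ Icc (-1 : ℝ) 1, u x ≤ M) {x : ℝ} (hx : x < 1) :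
    Ioi (0 : ℝ) ∩ {t | 1 - (volume {y ∈ Icc (-1 : ℝ) 1 | u y > t}).toReal ≤ x} ⊆ Ioo 0 M := by
  rintro t ⟨ht, hle⟩
  refine ⟨ht, ?_⟩
  by_contra! h
  have : {y ∈ Icc (-1 : ℝ) 1 | u y > t} = ∅ := by
    ext y
    simp only [mem_ofPred_eq, mem_empty_iff_false, iff_false, not_and, not_lt]
    exact fun hy => (hM y hy).trans h
  simp only [mem_ofPred_eq, this, measure_empty, ENNReal.toReal_zero] at hle
  linarith

lemma mrear_mono {M : ℝ} (hM : ∀ x ∈ Icc (-1 : ℝ) 1, u x ≤ M) {x y : ℝ} (hxy : x ≤ y)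
    (hy : y < 1) : mrear u x ≤ mrear u y := by
  rw [mrear_eq_volume u (hxy.trans_lt hy), mrear_eq_volume u hy]
  refine ENNReal.toReal_mono (measure_ne_top_of_subset (superlevel_subset_Ioo hM hy)
    measure_Ioo_lt_top.ne) (measure_mono ?_)
  exact fun t ht => ⟨ht.1, le_trans ht.2 hxy⟩

lemma le_mrear {M : ℝ} (hM : ∀ x ∈ Icc (-1 : ℝ) 1, u x ≤ M) {x t : ℝ} (hx : x < 1) (ht : 0 ≤ t)
    (h : 1 - (volume {y ∈ Icc (-1 : ℝ) 1 | u y > t}).toReal ≤ x) : t ≤ mrear u x := by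
  rw [mrear_eq_volume u hx]
  have h1 : volume (Ioc 0 t) ≤ volume (Ioi (0 : ℝ) ∩
      {t | 1 - (volume {y ∈ Icc (-1 : ℝ) 1 | u y > t}).toReal ≤ x}) :=
    measure_mono fun s hs => ⟨hs.1, le_trans (sub_le_sub_left (distribution_antitone u hs.2) 1) h⟩
  have h2 := ENNReal.toReal_mono (measure_ne_top_of_subset (superlevel_subset_Ioo hM hx)
    measure_Ioo_lt_top.ne) h1
  rwa [Real.volume_Ioc, ENNReal.toReal_ofReal (by linarith), sub_zero] at h2

lemma mrear_le {x t : ℝ} (hx : x < 1) (ht : 0 ≤ t)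
    (h : x < 1 - (volume {y ∈ Icc (-1 : ℝ) 1 | u y > t}).toReal) : mrear u x ≤ t := by
  rw [mrear_eq_volume u hx]
  have h1 : volume (Ioi (0 : ℝ) ∩
      {t | 1 - (volume {y ∈ Icc (-1 : ℝ) 1 | u y > t}).toReal ≤ x}) ≤ volume (Ioc 0 t) := by
    refine measure_mono fun s hs => ⟨hs.1, ?_⟩
    by_contra! hts
    exact absurd hs.2 (not_le.2 (h.trans_le (sub_le_sub_left (distribution_antitone u hts.le) 1)))
  have h2 := ENNReal.toReal_mono measure_Ioc_lt_top.ne h1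
  rwa [Real.volume_Ioc, ENNReal.toReal_ofReal (by linarith), sub_zero] at h2

lemma volume_mrear_gt {M : ℝ} (hM : ∀ x ∈ Icc (-1 : ℝ) 1, u x ≤ M) {t : ℝ} (ht : 0 ≤ t) :
    volume {x ∈ Icc (-1 : ℝ) 1 | mrear u x > t} = volume {x ∈ Icc (-1 : ℝ) 1 | u x > t} := by
  apply le_antisymm
  · calc volume {x ∈ Icc (-1 : ℝ) 1 | mrear u x > t}
        ≤ volume (Icc (1 - (volume {y ∈ Icc (-1 : ℝ) 1 | u y > t}).toReal) 1) := by
          refine measure_mono fun x hx => ⟨?_, hx.1.2⟩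
          by_contra! h
          have h0 : (0 : ℝ) ≤ (volume {y ∈ Icc (-1 : ℝ) 1 | u y > t}).toReal :=
            ENNReal.toReal_nonneg
          exact absurd hx.2 (not_lt.2 (mrear_le (by linarith) ht h))
      _ = _ := by
          rw [Real.volume_Icc, sub_sub_cancel, ENNReal.ofReal_toReal (distribution_ne_top u t)]
  · have hstep : ∀ s, t < s → volume {x ∈ Icc (-1 : ℝ) 1 | u x > s}
        ≤ volume {x ∈ Icc (-1 : ℝ) 1 | mrear u x > t} := by
      intro s hs
      calc volume {x ∈ Icc (-1 : ℝ) 1 | u x > s}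
          = volume (Ico (1 - (volume {y ∈ Icc (-1 : ℝ) 1 | u y > s}).toReal) 1) := by
            rw [Real.volume_Ico, sub_sub_cancel, ENNReal.ofReal_toReal (distribution_ne_top u s)]
        _ ≤ _ := by
            refine measure_mono fun x hx => ⟨⟨?_, hx.2.le⟩, ?_⟩
            · linarith [hx.1, distribution_le_two u s]
            · exact lt_of_lt_of_le hs (le_mrear hM hx.2 (by linarith) hx.1)
    have hU : {x ∈ Icc (-1 : ℝ) 1 | u x > t}
        = ⋃ n : ℕ, {x ∈ Icc (-1 : ℝ) 1 | u x > t + 1 / ((n : ℝ) + 1)} := by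
      ext x
      simp only [mem_iUnion]
      constructor
      · rintro ⟨h1, h2⟩
        obtain ⟨n, hn⟩ := exists_nat_one_div_lt (sub_pos.2 h2)
        exact ⟨n, h1, by linarith⟩
      · rintro ⟨n, h1, h2⟩
        have : (0 : ℝ) < 1 / ((n : ℝ) + 1) := by positivity
        exact ⟨h1, by linarith⟩
    have hmono : Monotone fun n : ℕ => {x ∈ Icc (-1 : ℝ) 1 | u x > t + 1 / ((n : ℝ) + 1)} := by
      intro n m hnm x hx
      have : 1 / ((m : ℝ) + 1) ≤ 1 / ((n : ℝ) + 1) := by gcongr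
      exact ⟨hx.1, lt_of_le_of_lt (by linarith) hx.2⟩
    rw [hU]
    refine le_of_tendsto' (tendsto_measure_iUnion_atTop hmono) fun n => hstep _ ?_
    have : (0 : ℝ) < 1 / ((n : ℝ) + 1) := by positivity
    linarith

lemma aemeasurable_mrear {M : ℝ} (hM : ∀ x ∈ Icc (-1 : ℝ) 1, u x ≤ M) :
    AEMeasurable (mrear u) (volume.restrict (Icc (-1 : ℝ) 1)) := by
  rw [← restrict_Ico_eq_restrict_Icc]
  exact aemeasurable_restrict_of_monotoneOn measurableSet_Ico
    fun x _ y hy hxy => mrear_mono hM hxy hy.2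

lemma map_mrear {M : ℝ} (hM : ∀ x ∈ Icc (-1 : ℝ) 1, u x ≤ M) (hu : Measurable u)
    (hnn : ∀ x, 0 ≤ u x) :
    Measure.map (mrear u) (volume.restrict (Icc (-1 : ℝ) 1))
      = Measure.map u (volume.restrict (Icc (-1 : ℝ) 1)) := by
  have hm := aemeasurable_mrear hM
  refine Measure.ext_of_Iic _ _ fun t => ?_
  rcases lt_or_ge t 0 with ht | ht
  · rw [Measure.map_apply_of_aemeasurable hm measurableSet_Iic, Measure.map_apply hu
      measurableSet_Iic]
    have h1 : mrear u ⁻¹' Iic t = ∅ := by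
      ext x; simpa using ht.trans_le (mrear_nonneg u x)
    have h2 : u ⁻¹' Iic t = ∅ := by
      ext x; simpa using ht.trans_le (hnn x)
    rw [h1, h2]
  · have hI : Measure.map (mrear u) (volume.restrict (Icc (-1 : ℝ) 1)) (Ioi t)
        = Measure.map u (volume.restrict (Icc (-1 : ℝ) 1)) (Ioi t) := by
      rw [Measure.map_apply_of_aemeasurable hm measurableSet_Ioi, Measure.map_apply hu
        measurableSet_Ioi, Measure.restrict_apply' measurableSet_Icc,
        Measure.restrict_apply' measurableSet_Icc, inter_comm, inter_comm (u ⁻¹' _)]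
      exact volume_mrear_gt hM ht
    have huniv : Measure.map (mrear u) (volume.restrict (Icc (-1 : ℝ) 1)) univ
        = Measure.map u (volume.restrict (Icc (-1 : ℝ) 1)) univ := by
      rw [Measure.map_apply_of_aemeasurable hm MeasurableSet.univ, Measure.map_apply hu
        MeasurableSet.univ, preimage_univ, preimage_univ]
    rw [← compl_Ioi, measure_compl measurableSet_Ioi (measure_ne_top _ _),
      measure_compl measurableSet_Ioi (measure_ne_top _ _), hI, huniv]

end Rearrangement

lemma sum_slope_ratio_le_one {u w : ℝ → ℝ} {v x₀ q : ℝ}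
    (hequi : ∀ r, volume {x ∈ Icc (-1 : ℝ) 1 | |w x - v| < r}
      = volume {x ∈ Icc (-1 : ℝ) 1 | |u x - v| < r})
    (hmono : MonotoneOn w (Ico (-1) 1)) (hx₀ : x₀ ∈ Ioo (-1 : ℝ) 1) (hw : w x₀ = v)
    (hwd : HasDerivAt w q x₀) (hq : 0 < q) (S : Finset ℝ) {d : ℝ → ℝ}
    (hS : ∀ x ∈ S, x ∈ Ioo (-1 : ℝ) 1 ∧ u x = v ∧ HasDerivAt u (d x) x ∧ d x ≠ 0) :
    ∑ x ∈ S, q / |d x| ≤ 1 := by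
  have key : ∀ η, 0 < η → η < q → ∑ x ∈ S, (q - η) / (|d x| + η) ≤ 1 := by
    intro η hη hηq
    have hqη : 0 < q - η := by linarith
    have h1 := hwd.isLittleO.def hη
    rw [Metric.eventually_nhds_iff] at h1
    obtain ⟨δ₁, hδ₁, H1⟩ := h1
    have h2 : ∀ᶠ ε in nhdsWithin (0 : ℝ) (Ioi 0), ∀ x ∈ S, (∀ y, |y - x| < ε → |u y - v| ≤ (|d x| + η) * |y - x|)
        ∧ ε < 1 - x ∧ ε < x + 1 ∧ ∀ y ∈ S, y ≠ x → 2 * ε < |y - x| := by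
      rw [Finset.eventually_all]
      intro x hx
      have hx' := hS x hx
      have hlt : ∀ c : ℝ, 0 < c → ∀ᶠ ε in nhdsWithin (0 : ℝ) (Ioi 0), ε < c := fun c hc =>
        (eventually_lt_nhds hc).filter_mono nhdsWithin_le_nhds
      refine Filter.Eventually.and ?_ ((hlt _ (by linarith [hx'.1.2])).and
        ((hlt _ (by linarith [hx'.1.1])).and ?_))
      · have h3 := hx'.2.2.1.isLittleO.def hη
        rw [Metric.eventually_nhds_iff] at h3
        obtain ⟨δ, hδ, H⟩ := h3
        filter_upwards [hlt δ hδ] with ε hε y hy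
        have h4 := H (show dist y x < δ by rw [Real.dist_eq]; linarith)
        simp only [smul_eq_mul, Real.norm_eq_abs, hx'.2.1] at h4
        calc |u y - v| = |(u y - v - (y - x) * d x) + (y - x) * d x| := by ring_nf
          _ ≤ |u y - v - (y - x) * d x| + |(y - x) * d x| := abs_add_le _ _
          _ ≤ η * |y - x| + |y - x| * |d x| := by rw [abs_mul]; gcongr
          _ = _ := by ring
      · rw [Finset.eventually_all]
        intro y hy
        by_cases hyx : y = x
        · exact Eventually.of_forall fun ε h => absurd hyx h
        · filter_upwards [hlt (|y - x| / 2) (by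
            have := abs_pos.2 (sub_ne_zero.2 hyx); positivity)] with ε hε _
          linarith
    obtain ⟨ε, hε, hεpos⟩ := (h2.and self_mem_nhdsWithin).exists
    have hεpos : 0 < ε := hεpos
    obtain ⟨δ, hδ0, hδ⟩ := exists_between (show 0 < min (min δ₁ (1 - x₀))
      (min (x₀ + 1) (ε * η / (q - η))) from
        lt_min (lt_min hδ₁ (by linarith [hx₀.2])) (lt_min (by linarith [hx₀.1]) (by positivity)))
    obtain ⟨hδa, hδb⟩ := lt_min_iff.1 hδ
    obtain ⟨hδ1, hδ2⟩ := lt_min_iff.1 hδa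
    obtain ⟨hδ3, hδ4⟩ := lt_min_iff.1 hδb
    rw [lt_div_iff₀ hqη] at hδ4
    set r : ℝ → ℝ := fun x => (q - η) * δ / (|d x| + η) with hr
    have hden : ∀ x, 0 < |d x| + η := fun x => by positivity
    have hrpos : ∀ x, 0 < r x := fun x => div_pos (mul_pos hqη hδ0) (hden x)
    have hrε : ∀ x, r x < ε := fun x => by
      rw [hr, div_lt_iff₀ (hden x)]
      nlinarith [mul_nonneg hεpos.le (abs_nonneg (d x))]
    have hup : volume {x ∈ Icc (-1 : ℝ) 1 | |w x - v| < (q - η) * δ} ≤ ENNReal.ofReal (2 * δ) := by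
      have hsub : {x ∈ Icc (-1 : ℝ) 1 | |w x - v| < (q - η) * δ}
          ⊆ Ioo (x₀ - δ) (x₀ + δ) ∪ {1} := by
        rintro x ⟨hx, hxw⟩
        rcases eq_or_lt_of_le hx.2 with h | h
        · exact Or.inr h
        · left
          rw [abs_lt] at hxw
          constructor
          · by_contra! hle
            have h3 := H1 (show dist (x₀ - δ) x₀ < δ₁ by
              rw [Real.dist_eq, sub_sub_cancel_left, abs_neg, abs_of_pos hδ0]; exact hδ1)
            simp only [smul_eq_mul, Real.norm_eq_abs, hw, sub_sub_cancel_left, abs_neg,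
              abs_of_pos hδ0] at h3
            have h4 := hmono ⟨hx.1, h⟩ ⟨by linarith, by linarith⟩ hle
            have h5 := (abs_le.1 h3).2
            nlinarith
          · by_contra! hle
            have h3 := H1 (show dist (x₀ + δ) x₀ < δ₁ by
              rw [Real.dist_eq, add_sub_cancel_left, abs_of_pos hδ0]; exact hδ1)
            simp only [smul_eq_mul, Real.norm_eq_abs, hw, add_sub_cancel_left,
              abs_of_pos hδ0] at h3
            have h4 := hmono ⟨by linarith [hx₀.1], by linarith⟩ ⟨hx.1, h⟩ hle
            have h5 := (abs_le.1 h3).1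
            nlinarith
      refine (measure_mono hsub).trans ((measure_union_le _ _).trans ?_)
      rw [Real.volume_Ioo, Real.volume_singleton, add_zero]
      exact ENNReal.ofReal_le_ofReal (by linarith)
    have hlow : ∑ x ∈ S, ENNReal.ofReal (2 * r x)
        ≤ volume {x ∈ Icc (-1 : ℝ) 1 | |u x - v| < (q - η) * δ} := by
      have h3 : volume (⋃ x ∈ S, Metric.ball x (r x)) = ∑ x ∈ S, ENNReal.ofReal (2 * r x) := by
        rw [measure_biUnion_finset]
        · simp only [Real.volume_ball]
        · intro x hx y hy hxy
          refine Metric.ball_disjoint_ball ?_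
          have := (hε y hy).2.2.2 x hx hxy
          rw [Real.dist_eq]
          linarith [hrε x, hrε y]
        · exact fun _ _ => measurableSet_ball
      rw [← h3]
      refine measure_mono fun y hy => ?_
      simp only [mem_iUnion] at hy
      obtain ⟨x, hx, hy⟩ := hy
      rw [Metric.mem_ball, Real.dist_eq] at hy
      have h4 := hε x hx
      have h5 := abs_lt.1 (hy.trans (hrε x))
      refine ⟨⟨by linarith, by linarith⟩, (h4.1 y (hy.trans (hrε x))).trans_lt ?_⟩
      rw [hr, lt_div_iff₀ (hden x)] at hy
      linarith
    rw [← hequi] at hlow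
    have h6 := hlow.trans hup
    rw [← ENNReal.ofReal_sum_of_nonneg (fun x _ => by linarith [hrpos x]),
      ENNReal.ofReal_le_ofReal_iff (by linarith), ← Finset.mul_sum] at h6
    have h7 : ∑ x ∈ S, r x = (∑ x ∈ S, (q - η) / (|d x| + η)) * δ := by
      rw [Finset.sum_mul]
      exact Finset.sum_congr rfl fun x _ => by simp only [hr]; ring
    rw [h7] at h6
    by_contra! hcon
    nlinarith
  have hcont : ContinuousAt (fun η : ℝ => ∑ x ∈ S, (q - η) / (|d x| + η)) 0 := by
    refine tendsto_finsetSum S fun x hx => ?_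
    have : |d x| + 0 ≠ 0 := by simpa using (hS x hx).2.2.2
    exact ContinuousAt.div (by fun_prop) (by fun_prop) this
  have hlim : Tendsto (fun η : ℝ => ∑ x ∈ S, (q - η) / (|d x| + η)) (nhdsWithin 0 (Ioi 0))
      (nhds (∑ x ∈ S, q / |d x|)) := by
    have := hcont.tendsto.mono_left (nhdsWithin_le_nhds (s := Ioi 0))
    simpa using this
  refine le_of_tendsto hlim ?_
  filter_upwards [Ioo_mem_nhdsGT hq] with η hη
  exact key η hη.1 hη.2

lemma strict_of_monotoneOn_of_hasDerivAt {w : ℝ → ℝ} (hmono : MonotoneOn w (Ico (-1) 1))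
    {x₀ d : ℝ} (hx₀ : x₀ ∈ Ioo (-1 : ℝ) 1) (hd : HasDerivAt w d x₀) (hne : d ≠ 0) :
    0 < d ∧ (∀ y ∈ Ico (-1 : ℝ) 1, x₀ < y → w x₀ < w y) ∧
      ∀ y ∈ Ico (-1 : ℝ) 1, y < x₀ → w y < w x₀ := by
  have hpos : 0 < d := by
    refine lt_of_le_of_ne ?_ hne.symm
    by_contra! hneg
    have h1 : HasDerivAt (fun x => -(w x - w x₀)) (-d) x₀ := (hd.sub_const _).neg
    obtain ⟨δ, hδ, H⟩ := exists_pos_mul_of_hasDerivAt h1 (by simp) (by linarith)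
    obtain ⟨y, hy1, hy2⟩ := exists_between (lt_min hx₀.2 (show x₀ < x₀ + δ by linarith))
    have hy3 := lt_min_iff.1 hy2
    have h2 := H y hy1.ne' (by rw [abs_of_pos (by linarith)]; linarith)
    have h3 := hmono ⟨hx₀.1.le, hx₀.2⟩ ⟨by linarith [hx₀.1], hy3.1⟩ hy1.le
    nlinarith
  have h1 : HasDerivAt (fun x => w x - w x₀) d x₀ := hd.sub_const _
  obtain ⟨δ, hδ, H⟩ := exists_pos_mul_of_hasDerivAt h1 (by simp) hpos
  refine ⟨hpos, fun y hy hlt => ?_, fun y hy hlt => ?_⟩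
  · obtain ⟨z, hz1, hz2⟩ := exists_between (lt_min hlt (show x₀ < x₀ + δ by linarith))
    have hz3 := lt_min_iff.1 hz2
    have h2 := H z hz1.ne' (by rw [abs_of_pos (by linarith)]; linarith)
    have h3 := hmono ⟨by linarith [hx₀.1], by linarith [hy.2]⟩ hy hz3.1.le
    have := pos_of_mul_pos_left h2 (by linarith)
    linarith
  · obtain ⟨z, hz1, hz2⟩ := exists_between (max_lt hlt (show x₀ - δ < x₀ by linarith))
    have hz3 := max_lt_iff.1 hz1
    have h2 := H z hz2.ne (by rw [abs_of_neg (by linarith)]; linarith)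
    have h3 := hmono hy ⟨by linarith [hy.1], by linarith [hx₀.2]⟩ hz3.1.le
    nlinarith

lemma finite_level_set {u : ℝ → ℝ} (hu : Continuous u) {v : ℝ}
    (hd : ∀ x ∈ Icc (-1 : ℝ) 1, u x = v → deriv u x ≠ 0) :
    {x ∈ Icc (-1 : ℝ) 1 | u x = v}.Finite := by
  by_contra hinf
  obtain ⟨x, hx, hacc⟩ := Set.Infinite.exists_accPt_of_subset_isCompact (K := Icc (-1 : ℝ) 1)
    hinf isCompact_Icc (fun x hx => hx.1)
  have hclosed : IsClosed {x ∈ Icc (-1 : ℝ) 1 | u x = v} :=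
    isClosed_Icc.inter (isClosed_eq hu continuous_const)
  have hxL : x ∈ {x ∈ Icc (-1 : ℝ) 1 | u x = v} :=
    hclosed.closure_subset_iff.2 subset_rfl (mem_closure_iff_clusterPt.2 hacc.clusterPt)
  have hder := hd x hx hxL.2
  have hev := (differentiableAt_of_deriv_ne_zero hder).hasDerivAt.eventually_ne (c := v) hder
  have hfr := accPt_iff_frequently_nhdsNE.1 hacc
  exact hfr (hev.mono fun y hy hyL => hy hyL.2)

/-- The part of the integrand of `Ifun` that depends on the derivative. -/
def gradPart (F a : ℝ → ℝ → ℝ) (z : ℝ → ℝ) (x : ℝ) : ℝ≥0∞ :=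
  ENNReal.ofReal (F (z x) (a x (z x) * |deriv z x|) - F (z x) 0)

lemma Ifun_eq_add {F a : ℝ → ℝ → ℝ} (hFc : Continuous fun p : ℝ × ℝ => F p.1 p.2)
    (hF0 : ∀ v p : ℝ, 0 ≤ v → 0 ≤ p → 0 ≤ F v p)
    (hFm : ∀ v : ℝ, 0 ≤ v → MonotoneOn (F v) (Ici 0))
    (ha0 : ∀ x ∈ Icc (-1 : ℝ) 1, ∀ v, 0 ≤ v → 0 ≤ a x v) {z : ℝ → ℝ} (hz : ∀ x, 0 ≤ z x)
    (hzm : AEMeasurable z (volume.restrict (Icc (-1 : ℝ) 1))) :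
    Ifun F a z = ∫⁻ v, ENNReal.ofReal (F v 0) ∂Measure.map z (volume.restrict (Icc (-1 : ℝ) 1))
      + ∫⁻ x in Icc (-1 : ℝ) 1, gradPart F a z x := by
  have hm : Measurable fun v => ENNReal.ofReal (F v 0) :=
    ENNReal.measurable_ofReal.comp
      (hFc.comp (continuous_id.prodMk continuous_const)).measurable
  have hm' : AEMeasurable (fun x => ENNReal.ofReal (F (z x) 0))
      (volume.restrict (Icc (-1 : ℝ) 1)) := hm.comp_aemeasurable hzm
  rw [lintegral_map' hm.aemeasurable hzm, ← lintegral_add_left' hm']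
  refine setLIntegral_congr_fun measurableSet_Icc fun x hx => ?_
  have h1 : 0 ≤ a x (z x) * |deriv z x| := mul_nonneg (ha0 x hx _ (hz x)) (abs_nonneg _)
  have h2 := hFm (z x) (hz x) (mem_Ici.2 le_rfl) (mem_Ici.2 h1) h1
  simp only [gradPart]
  rw [← ENNReal.ofReal_add (hF0 _ _ (hz x) le_rfl) (by linarith)]
  congr 1
  ring

lemma lintegral_gradPart_eq (F a : ℝ → ℝ → ℝ) (z : ℝ → ℝ) :
    ∫⁻ x in Icc (-1 : ℝ) 1, gradPart F a z x
      = ∫⁻ x in Ioo (-1 : ℝ) 1 ∩ {x | deriv z x ≠ 0}, gradPart F a z x := by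
  have hm : MeasurableSet {x | deriv z x ≠ 0} :=
    (measurableSet_eq_fun (measurable_deriv z) measurable_const).compl
  have hind : gradPart F a z = {x | deriv z x ≠ 0}.indicator (gradPart F a z) := by
    ext x
    by_cases h : deriv z x = 0
    · rw [indicator_of_notMem (by simpa using h)]
      simp [gradPart, h]
    · rw [indicator_of_mem (show x ∈ {x | deriv z x ≠ 0} from h)]
  rw [← restrict_Ioo_eq_restrict_Icc]
  conv_lhs => rw [hind]
  rw [setLIntegral_indicator hm, inter_comm]

lemma volume_image_critical_eq_zero {u : ℝ → ℝ} (hu : MemW11 u) :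
    volume (u '' ({x ∈ Icc (-1 : ℝ) 1 | deriv u x = 0} ∪ {-1, 1})) = 0 := by
  rw [image_union]
  refine measure_union_null ?_ ((Set.toFinite _).image u |>.measure_zero volume)
  have hf : Integrable ((Icc (-1 : ℝ) 1).indicator (deriv u)) :=
    hu.1.integrable_indicator measurableSet_Icc
  have hcongr : u '' {x ∈ Icc (-1 : ℝ) 1 | deriv u x = 0}
      = (fun x => u (-1) + ∫ t in (-1 : ℝ)..x, (Icc (-1 : ℝ) 1).indicator (deriv u) t) ''
        {x ∈ Icc (-1 : ℝ) 1 | deriv u x = 0} := by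
    refine image_congr fun x hx => ?_
    rw [hu.2 x hx.1]
    congr 1
    refine intervalIntegral.integral_congr fun t ht => ?_
    rw [uIcc_of_le hx.1.1] at ht
    rw [indicator_of_mem (show t ∈ Icc (-1 : ℝ) 1 from ⟨ht.1, ht.2.trans hx.1.2⟩)]
  rw [hcongr]
  refine volume_image_primitive_eq_zero hf _ ?_ fun x hx => ?_
  · exact measurableSet_Icc.inter (measurableSet_eq_fun (measurable_deriv u) measurable_const)
  · rw [indicator_of_mem hx.1]; exact hx.2

lemma gradPart_div_eq_ofReal {F a : ℝ → ℝ → ℝ} {z : ℝ → ℝ} {x : ℝ} (h : deriv z x ≠ 0) :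
    gradPart F a z x / ENNReal.ofReal |deriv z x|
      = ENNReal.ofReal ((F (z x) (a x (z x) * |deriv z x|) - F (z x) 0) / |deriv z x|) := by
  rw [gradPart, ENNReal.ofReal_div_of_pos (abs_pos.2 h)]

lemma volume_abs_mrear_sub_lt {u : ℝ → ℝ} {M : ℝ} (hM : ∀ x ∈ Icc (-1 : ℝ) 1, u x ≤ M)
    (hu : Measurable u) (hnn : ∀ x, 0 ≤ u x) (v r : ℝ) :
    volume {x ∈ Icc (-1 : ℝ) 1 | |mrear u x - v| < r}
      = volume {x ∈ Icc (-1 : ℝ) 1 | |u x - v| < r} := by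
  have hm : MeasurableSet {y : ℝ | |y - v| < r} :=
    (isOpen_lt (continuous_id.sub continuous_const).abs continuous_const).measurableSet
  have h := congrArg (fun μ => μ {y : ℝ | |y - v| < r}) (map_mrear hM hu hnn)
  simp only [Measure.map_apply_of_aemeasurable (aemeasurable_mrear hM) hm,
    Measure.map_apply hu hm, Measure.restrict_apply' measurableSet_Icc] at h
  rw [inter_comm, inter_comm _ (Icc (-1 : ℝ) 1)] at h
  exact h

/-- The fiberwise comparison: at a regular value `mrear u x₀` the contribution of the
rearrangement is bounded by the sum of the contributions of `u` over the level set. -/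
lemma exists_fiber_sum_le {F a : ℝ → ℝ → ℝ}
    (hFconv : ∀ v : ℝ, 0 ≤ v → ConvexOn ℝ (Ici 0) (F v))
    (hFm : ∀ v : ℝ, 0 ≤ v → MonotoneOn (F v) (Ici 0))
    (ha0 : ∀ x ∈ Icc (-1 : ℝ) 1, ∀ v, 0 ≤ v → 0 ≤ a x v)
    (heven : ∀ x v : ℝ, x ∈ Icc (-1 : ℝ) 1 → 0 ≤ v → a x v = a (-x) v) (hC : CondC a)
    {u : ℝ → ℝ} (hu : Continuous u) (hnn : ∀ x, 0 ≤ u x) {M : ℝ}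
    (hM : ∀ x ∈ Icc (-1 : ℝ) 1, u x ≤ M) {x₀ : ℝ} (hx₀ : x₀ ∈ Ioo (-1 : ℝ) 1)
    (hx₀d : deriv (mrear u) x₀ ≠ 0)
    (hreg : mrear u x₀ ∉ u '' ({x ∈ Icc (-1 : ℝ) 1 | deriv u x = 0} ∪ {-1, 1})) :
    ∃ S : Finset ℝ, ↑S ⊆ Ioo (-1 : ℝ) 1 ∩ {x | deriv u x ≠ 0} ∧ (∀ x ∈ S, u x = mrear u x₀) ∧
      gradPart F a (mrear u) x₀ / ENNReal.ofReal |deriv (mrear u) x₀|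
        ≤ ∑ x ∈ S, gradPart F a u x / ENNReal.ofReal |deriv u x| := by
  set w := mrear u with hw
  set v := w x₀ with hv
  have hv0 : 0 ≤ v := mrear_nonneg u x₀
  have hmono : MonotoneOn w (Ico (-1) 1) := fun x _ y hy hxy => mrear_mono hM hxy hy.2
  have hwd : HasDerivAt w (deriv w x₀) x₀ :=
    (differentiableAt_of_deriv_ne_zero hx₀d).hasDerivAt
  obtain ⟨hq, hlt, hgt⟩ := strict_of_monotoneOn_of_hasDerivAt hmono hx₀ hwd hx₀d
  have hend : ∀ x ∈ Icc (-1 : ℝ) 1, u x = v → x ∈ Ioo (-1 : ℝ) 1 ∧ deriv u x ≠ 0 := by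
    intro x hx hxv
    refine ⟨⟨lt_of_le_of_ne hx.1 fun h => hreg ⟨x, Or.inr (by simp [← h]), hxv⟩,
      lt_of_le_of_ne hx.2 fun h => hreg ⟨x, Or.inr (by simp [h]), hxv⟩⟩,
      fun h => hreg ⟨x, Or.inl ⟨hx, h⟩, hxv⟩⟩
  have hfin := finite_level_set hu (v := v) fun x hx hxv => (hend x hx hxv).2
  set S := hfin.toFinset with hSdef
  have hS : ∀ x, x ∈ S ↔ x ∈ Icc (-1 : ℝ) 1 ∧ u x = v := fun x => hfin.mem_toFinset
  have hSd : ∀ x ∈ S, x ∈ Ioo (-1 : ℝ) 1 ∧ u x = v ∧ HasDerivAt u (deriv u x) x ∧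
      deriv u x ≠ 0 := by
    intro x hx
    obtain ⟨h1, h2⟩ := (hS x).1 hx
    obtain ⟨h3, h4⟩ := hend x h1 h2
    exact ⟨h3, h2, (differentiableAt_of_deriv_ne_zero h4).hasDerivAt, h4⟩
  have hvol : volume {x ∈ Icc (-1 : ℝ) 1 | u x > v} = ENNReal.ofReal (1 - x₀) := by
    rw [← volume_mrear_gt hM hv0]
    apply le_antisymm
    · rw [← Real.volume_Icc]
      refine measure_mono fun x hx => ⟨?_, hx.1.2⟩
      by_contra! h
      exact absurd hx.2 (not_lt.2 (hgt x ⟨hx.1.1, by linarith [hx₀.2]⟩ h).le)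
    · rw [← Real.volume_Ioo]
      exact measure_mono fun x hx => ⟨⟨by linarith [hx₀.1, hx.1], hx.2.le⟩,
        hlt x ⟨by linarith [hx₀.1, hx.1], hx.2⟩ hx.1⟩
  have hSne : S.Nonempty := by
    obtain ⟨y, hy, hyv⟩ : ∃ y ∈ Icc (-1 : ℝ) 1, v < u y := by
      by_contra! h
      have : {x ∈ Icc (-1 : ℝ) 1 | u x > v} = ∅ :=
        eq_empty_of_forall_notMem fun x hx => not_lt.2 (h x hx.1) hx.2
      rw [this, measure_empty, eq_comm, ENNReal.ofReal_eq_zero] at hvol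
      linarith [hx₀.2]
    obtain ⟨z, hz, hzv⟩ : ∃ z ∈ Icc (-1 : ℝ) 1, u z ≤ v := by
      by_contra! h
      have : {x ∈ Icc (-1 : ℝ) 1 | u x > v} = Icc (-1 : ℝ) 1 :=
        Subset.antisymm (fun x hx => hx.1) fun x hx => ⟨hx, h x hx⟩
      rw [this, Real.volume_Icc, ENNReal.ofReal_eq_ofReal_iff (by norm_num)
        (by linarith [hx₀.2])] at hvol
      linarith [hx₀.1]
    obtain ⟨x, hx, hxv⟩ := isPreconnected_Icc.intermediate_value hz hy hu.continuousOn
      ⟨hzv, hyv.le⟩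
    exact ⟨x, (hS x).2 ⟨hx, hxv⟩⟩
  have hle : a x₀ v ≤ ∑ x ∈ S, a x v := by
    have h := weight_le_sum (b := fun x => a x v) (fun s t h1 h2 h3 => hC s t v h1 h2 h3 hv0)
      (fun x hx => heven x v hx hv0) hSne (g := fun x => u x - v) (g' := deriv u)
      (hu.sub continuous_const)
      (fun x hx => by rw [sub_eq_zero, hS x]; exact ⟨fun h => ⟨hx, h⟩, fun h => h.2⟩)
      (fun x hx => ⟨(hSd x hx).1, (hSd x hx).2.2.1.sub_const _, (hSd x hx).2.2.2⟩)
    have hset : {x ∈ Icc (-1 : ℝ) 1 | 0 < u x - v} = {x ∈ Icc (-1 : ℝ) 1 | u x > v} := by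
      ext x; simp [sub_pos]
    rw [hset, hvol, ENNReal.toReal_ofReal (by linarith [hx₀.2])] at h
    simpa using h
  have hsum := sum_slope_ratio_le_one (volume_abs_mrear_sub_lt hM hu.measurable hnn v) hmono hx₀
    rfl hwd hq S hSd
  have hb : ∀ x ∈ S, 0 ≤ a x v := fun x hx => ha0 x ((hS x).1 hx).1 v hv0
  have hp : ∀ x ∈ S, 0 < |deriv u x| := fun x hx => abs_pos.2 (hSd x hx).2.2.2
  have hJ := jensen_weighted S (hFconv v hv0) (hFm v hv0) hq hp hb
    (ha0 x₀ (Ioo_subset_Icc_self hx₀) v hv0) hsum hle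
  refine ⟨S, fun x hx => ⟨(hSd x hx).1, (hSd x hx).2.2.2⟩, fun x hx => (hSd x hx).2.1, ?_⟩
  rw [gradPart_div_eq_ofReal hx₀d, ← hv, abs_of_pos hq]
  calc _ ≤ ENNReal.ofReal (∑ x ∈ S, (F v (a x v * |deriv u x|) - F v 0) / |deriv u x|) :=
        ENNReal.ofReal_le_ofReal hJ
    _ = _ := by
        rw [ENNReal.ofReal_sum_of_nonneg fun x hx => div_nonneg (sub_nonneg.2 ?_) (hp x hx).le]
        · refine Finset.sum_congr rfl fun x hx => ?_
          rw [gradPart_div_eq_ofReal (hSd x hx).2.2.2, (hSd x hx).2.1]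
        · have := mul_nonneg (hb x hx) (hp x hx).le
          exact hFm v hv0 (mem_Ici.2 le_rfl) (mem_Ici.2 this) this

lemma measurable_gradPart {F a : ℝ → ℝ → ℝ} (hFc : Continuous fun p : ℝ × ℝ => F p.1 p.2)
    (hac : Continuous fun p : ℝ × ℝ => a p.1 p.2) {u : ℝ → ℝ} (hu : Continuous u) :
    Measurable (gradPart F a u) := by
  have h1 : Measurable fun x => a x (u x) :=
    (hac.comp (continuous_id.prodMk hu)).measurable
  have h2 : Measurable fun x => F (u x) (a x (u x) * |deriv u x|) :=
    hFc.measurable.comp (hu.measurable.prodMk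
      (h1.mul (continuous_abs.measurable.comp (measurable_deriv u))))
  have h3 : Measurable fun x => F (u x) 0 :=
    (hFc.comp (hu.prodMk continuous_const)).measurable
  exact ENNReal.measurable_ofReal.comp (h2.sub h3)

lemma Ifun_mrear_le_of_continuous {F a : ℝ → ℝ → ℝ}
    (hFc : Continuous fun p : ℝ × ℝ => F p.1 p.2)
    (hac : Continuous fun p : ℝ × ℝ => a p.1 p.2)
    (hF0 : ∀ v p : ℝ, 0 ≤ v → 0 ≤ p → 0 ≤ F v p)
    (hFconv : ∀ v : ℝ, 0 ≤ v → ConvexOn ℝ (Ici 0) (F v))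
    (hFm : ∀ v : ℝ, 0 ≤ v → MonotoneOn (F v) (Ici 0))
    (ha0 : ∀ x ∈ Icc (-1 : ℝ) 1, ∀ v, 0 ≤ v → 0 ≤ a x v)
    (heven : ∀ x v : ℝ, x ∈ Icc (-1 : ℝ) 1 → 0 ≤ v → a x v = a (-x) v) (hC : CondC a)
    {u : ℝ → ℝ} (hu : Continuous u) (hnn : ∀ x, 0 ≤ u x) (huW : MemW11 u) :
    Ifun F a (mrear u) ≤ Ifun F a u := by
  obtain ⟨M, hM'⟩ := isCompact_Icc.bddAbove_image (K := Icc (-1 : ℝ) 1) hu.continuousOn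
  have hM : ∀ x ∈ Icc (-1 : ℝ) 1, u x ≤ M := fun x hx => hM' (mem_image_of_mem u hx)
  rw [Ifun_eq_add hFc hF0 hFm ha0 (mrear_nonneg u) (aemeasurable_mrear hM),
    Ifun_eq_add hFc hF0 hFm ha0 hnn hu.aemeasurable, map_mrear hM hu.measurable hnn,
    lintegral_gradPart_eq, lintegral_gradPart_eq]
  refine add_le_add_right ?_ _
  set w := mrear u with hw
  set E := Ioo (-1 : ℝ) 1 ∩ {x | deriv u x ≠ 0} with hE
  set E' := Ioo (-1 : ℝ) 1 ∩ {x | deriv w x ≠ 0} with hE'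
  have hmeas : ∀ z : ℝ → ℝ, MeasurableSet (Ioo (-1 : ℝ) 1 ∩ {x | deriv z x ≠ 0}) := fun z =>
    measurableSet_Ioo.inter (measurableSet_eq_fun (measurable_deriv z) measurable_const).compl
  have hder : ∀ z : ℝ → ℝ, ∀ x ∈ Ioo (-1 : ℝ) 1 ∩ {x | deriv z x ≠ 0},
      HasDerivWithinAt z (deriv z x) (Ioo (-1 : ℝ) 1 ∩ {x | deriv z x ≠ 0}) x := fun z x hx =>
    (differentiableAt_of_deriv_ne_zero hx.2).hasDerivAt.hasDerivWithinAt
  have hcancel : ∀ z : ℝ → ℝ, ∀ x ∈ Ioo (-1 : ℝ) 1 ∩ {x | deriv z x ≠ 0},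
      gradPart F a z x
        = ENNReal.ofReal |deriv z x| * (gradPart F a z x / ENNReal.ofReal |deriv z x|) :=
    fun z x hx => (ENNReal.mul_div_cancel (by simpa using hx.2) ENNReal.ofReal_ne_top).symm
  have hmono : MonotoneOn w (Ico (-1) 1) := fun x _ y hy hxy => mrear_mono hM hxy hy.2
  have hinj : InjOn w E' := by
    have hstrict : StrictMonoOn w E' := fun x hx y hy hxy =>
      (strict_of_monotoneOn_of_hasDerivAt hmono hx.1
        (differentiableAt_of_deriv_ne_zero hx.2).hasDerivAt hx.2).2.1 y
        (Ioo_subset_Ico_self hy.1) hxy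
    exact hstrict.injOn
  have himg : MeasurableSet (w '' E') :=
    measurable_image_of_fderivWithin (hmeas w) (fun x hx => (hder w x hx).hasFDerivWithinAt) hinj
  set h : ℝ → ℝ≥0∞ := fun x => gradPart F a w x / ENNReal.ofReal |deriv w x| with hh
  set g : ℝ → ℝ≥0∞ := fun v => h (Function.invFunOn w E' v) with hg
  have hleft : ∀ x ∈ E', g (w x) = h x := fun x hx => by
    simp only [hg]
    rw [hinj.leftInvOn_invFunOn hx]
  calc ∫⁻ x in E', gradPart F a w x = ∫⁻ x in E', ENNReal.ofReal |deriv w x| * g (w x) :=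
        setLIntegral_congr_fun (hmeas w) fun x hx => by
          rw [hcancel w x hx]; simp only [hleft x hx, hh]
    _ = ∫⁻ v in w '' E', g v :=
        (lintegral_image_eq_lintegral_abs_deriv_mul (hmeas w) (hder w) hinj g).symm
    _ = ∫⁻ v, (w '' E').indicator g v := (lintegral_indicator himg g).symm
    _ ≤ ∫⁻ x in E, ENNReal.ofReal |deriv u x|
          * (gradPart F a u x / ENNReal.ofReal |deriv u x|) := by
        refine lintegral_le_of_fiberwise_le (hmeas u) (hder u) (fun x hx => hx.2) ?_ ?_
        · exact (measurable_gradPart hFc hac hu).div (ENNReal.measurable_ofReal.comp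
            (continuous_abs.measurable.comp (measurable_deriv u)))
        · filter_upwards [measure_eq_zero_iff_ae_notMem.1 (volume_image_critical_eq_zero huW)]
            with v hv
          by_cases hvE : v ∈ w '' E'
          · obtain ⟨x₀, hx₀, rfl⟩ := hvE
            rw [indicator_of_mem (mem_image_of_mem w hx₀), hleft x₀ hx₀]
            exact exists_fiber_sum_le hFconv hFm ha0 heven hC hu hnn hM hx₀.1 hx₀.2 hv
          · exact ⟨∅, by simp, by simp, by simp [indicator_of_notMem hvE]⟩
    _ = ∫⁻ x in E, gradPart F a u x :=
        setLIntegral_congr_fun (hmeas u) fun x hx => (hcancel u x hx).symm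

lemma MemW11.continuousOn {u : ℝ → ℝ} (hu : MemW11 u) : ContinuousOn u (Icc (-1) 1) := by
  have h : ContinuousOn (fun x => ∫ t in (-1 : ℝ)..x, deriv u t) (uIcc (-1) 1) :=
    intervalIntegral.continuousOn_primitive_interval
      (by rw [uIcc_of_le (by norm_num)]; exact hu.1)
  rw [uIcc_of_le (by norm_num)] at h
  exact (continuousOn_const.add h).congr hu.2

lemma deriv_eq_of_eqOn_Icc {u z : ℝ → ℝ} (h : EqOn z u (Icc (-1) 1)) {x : ℝ}
    (hx : x ∈ Ioo (-1 : ℝ) 1) : deriv z x = deriv u x :=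
  (h.mono Ioo_subset_Icc_self).eventuallyEq_of_mem (Ioo_mem_nhds hx.1 hx.2) |>.deriv_eq

lemma MemW11.congr {u z : ℝ → ℝ} (hu : MemW11 u) (h : EqOn z u (Icc (-1) 1)) : MemW11 z := by
  constructor
  · rw [integrableOn_Icc_iff_integrableOn_Ioo]
    exact (hu.1.mono_set Ioo_subset_Icc_self).congr_fun
      (fun x hx => (deriv_eq_of_eqOn_Icc h hx).symm) measurableSet_Ioo
  · intro x hx
    rw [h hx, h (left_mem_Icc.2 (by norm_num)), hu.2 x hx]
    congr 1
    rw [intervalIntegral.integral_of_le hx.1, intervalIntegral.integral_of_le hx.1,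
      integral_Ioc_eq_integral_Ioo, integral_Ioc_eq_integral_Ioo]
    exact setIntegral_congr_fun measurableSet_Ioo fun t ht =>
      (deriv_eq_of_eqOn_Icc h ⟨ht.1, ht.2.trans_le hx.2⟩).symm

lemma mrear_congr {u z : ℝ → ℝ} (h : EqOn z u (Icc (-1) 1)) : mrear z = mrear u := by
  have : ∀ t, {y ∈ Icc (-1 : ℝ) 1 | z y > t} = {y ∈ Icc (-1 : ℝ) 1 | u y > t} := fun t => by
    ext y
    exact and_congr_right fun hy => by rw [h hy]
  ext x
  simp only [mrear, this]

lemma Ifun_congr {F G a b : ℝ → ℝ → ℝ} {u z : ℝ → ℝ} (h : EqOn z u (Icc (-1) 1))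
    (hnn : ∀ x ∈ Icc (-1 : ℝ) 1, 0 ≤ u x)
    (hab : ∀ x ∈ Icc (-1 : ℝ) 1, ∀ v, 0 ≤ v → 0 ≤ a x v ∧ b x v = a x v)
    (hFG : ∀ v p, 0 ≤ v → 0 ≤ p → G v p = F v p) : Ifun G b z = Ifun F a u := by
  unfold Ifun
  rw [← restrict_Ioo_eq_restrict_Icc]
  refine setLIntegral_congr_fun measurableSet_Ioo fun x hx => ?_
  have hx' := Ioo_subset_Icc_self hx
  obtain ⟨h0, h1⟩ := hab x hx' _ (hnn x hx')
  simp only [deriv_eq_of_eqOn_Icc h hx, h hx', h1,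
    hFG _ _ (hnn x hx') (mul_nonneg h0 (abs_nonneg (deriv u x)))]

/-- Main theorem: `I(a,u*) ≤ I(a,u)` for every nonnegative `u ∈ W¹₁(-1,1)`
and every continuous weight that is even in `x` and satisfies condition (C). -/
theorem stmt15 (a F : ℝ → ℝ → ℝ) (ha : Weight a) (hF : MemFrakF F)
    (heven : ∀ x v : ℝ, x ∈ Icc (-1 : ℝ) 1 → 0 ≤ v → a x v = a (-x) v)
    (hC : CondC a)
    (u : ℝ → ℝ) (hu : MemW11 u) (hnn : ∀ x ∈ Icc (-1 : ℝ) 1, 0 ≤ u x) :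
    Ifun F a (mrear u) ≤ Ifun F a u := by
  have hproj : ∀ x ∈ Icc (-1 : ℝ) 1, max (-1) (min 1 x) = x := fun x hx => by
    rw [min_eq_right hx.2, max_eq_right hx.1]
  have hprojmem : ∀ x : ℝ, max (-1) (min 1 x) ∈ Icc (-1 : ℝ) 1 := fun x =>
    ⟨le_max_left _ _, max_le (by norm_num) (min_le_left _ _)⟩
  have hcp : Continuous fun x : ℝ => max (-1) (min 1 x) := by fun_prop
  set z : ℝ → ℝ := fun x => u (max (-1) (min 1 x)) with hz
  set G : ℝ → ℝ → ℝ := fun v p => F (max v 0) (max p 0) with hG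
  set b : ℝ → ℝ → ℝ := fun x v => a (max (-1) (min 1 x)) (max v 0) with hb
  have hzu : EqOn z u (Icc (-1) 1) := fun x hx => by simp only [hz, hproj x hx]
  have hGF : ∀ v p, 0 ≤ v → 0 ≤ p → G v p = F v p := fun v p hv hp => by
    simp only [hG, max_eq_left hv, max_eq_left hp]
  have hba : ∀ x ∈ Icc (-1 : ℝ) 1, ∀ v, 0 ≤ v → b x v = a x v := fun x hx v hv => by
    simp only [hb, hproj x hx, max_eq_left hv]
  have hab : ∀ x ∈ Icc (-1 : ℝ) 1, ∀ v, 0 ≤ v → 0 ≤ a x v ∧ b x v = a x v :=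
    fun x hx v hv => ⟨ha.2 x v hx hv, hba x hx v hv⟩
  have hGv : ∀ v, 0 ≤ v → EqOn (F v) (G v) (Ici 0) := fun v hv p hp => (hGF v p hv hp).symm
  rw [← Ifun_congr (z := mrear z) (u := mrear u) (fun x _ => by rw [mrear_congr hzu])
      (fun x _ => mrear_nonneg u x) hab hGF,
    ← Ifun_congr hzu hnn hab hGF]
  refine Ifun_mrear_le_of_continuous ?_ ?_ (fun v p hv hp => ?_) (fun v hv => ?_) (fun v hv => ?_)
    (fun x hx v hv => ?_) (fun x v hx hv => ?_) (fun s t v hs hst ht hv => ?_) ?_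
    (fun x => hnn _ (hprojmem x)) (hu.congr hzu)
  · exact hF.1.comp_continuous (f := fun p : ℝ × ℝ => (max p.1 0, max p.2 0)) (by fun_prop)
      fun p => ⟨le_max_right p.1 0, le_max_right p.2 0⟩
  · exact ha.1.comp_continuous (f := fun p : ℝ × ℝ => (max (-1) (min 1 p.1), max p.2 0))
      (by fun_prop) fun p => ⟨hprojmem p.1, le_max_right p.2 0⟩
  · rw [hGF v p hv hp]; exact hF.2.1 v p hv hp
  · exact (hF.2.2.1 v hv).congr (hGv v hv)
  · exact (hF.2.2.2 v hv).congr (hGv v hv)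
  · rw [hba x hx v hv]; exact ha.2 x v hx hv
  · rw [hba x hx v hv, hba (-x) ⟨by linarith [hx.2], by linarith [hx.1]⟩ v hv]
    exact heven x v hx hv
  · rw [hba s ⟨hs, hst.trans ht⟩ v hv, hba t ⟨hs.trans hst, ht⟩ v hv,
      hba (1 - t + s) ⟨by linarith, by linarith⟩ v hv]
    exact hC s t v hs hst ht hv
  · exact hu.continuousOn.comp_continuous hcp hprojmem
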